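/- Let (G,E) be a self-similar action. Then: (1) the inverse semigroup S(G,E) is topologically free if and only if both (Cyc) for every g ∈ G every g-cycle has an entrance, and (Evr) if g ∈ G fixes every path in s(g)E^* then g strongly fixes some path in s(g)E^*; (2) S(G,E) is effective if and only if both (Cyc) holds and (Sla) if g ∈ G fixes every path in s(g)E^* then g has slack. -/

import Mathlib

noncomputable section

attribute [local instance] Classical.propDecidable

/-- Raw algebraic data of an inverse semigroup with zero, together with a domain
predicate singling out its genuine elements (the carrier may contain junk). -/
structure RawSem (T : Type) where
  mul : T → T → T
  star : T → T
  zero : T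
  dom : T → Prop

namespace RawSem

variable {T : Type} (R : RawSem T)

/-- The natural partial order: `t ≤ u` iff `t = u ⬝ t* ⬝ t`. -/
def le (t u : T) : Prop := t = R.mul u (R.mul (R.star t) t)

/-- Nonzero idempotents (belonging to the domain). -/
def NzIdem (e : T) : Prop := R.dom e ∧ R.mul e e = e ∧ e ≠ R.zero

/-- `F` covers the idempotent `e`: every nonzero idempotent below `e` meets some `f ∈ F`. -/
def Covers (F : Set T) (e : T) : Prop :=
  ∀ z, R.NzIdem z → R.le z e → ∃ f ∈ F, R.mul z f ≠ R.zero

/-- The set `F_t` of nonzero idempotents trivially fixed by `t`, i.e. `≤ t`. -/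
def TrivFix (t : T) : Set T := {e | R.NzIdem e ∧ R.le e t}

/-- The idempotent `e` is fixed by `t`:
`(t ⬝ f ⬝ t*) ⬝ f ≠ 0` for every nonzero idempotent `f ≤ e`. -/
def FixedBy (e t : T) : Prop :=
  ∀ f, R.NzIdem f → R.le f e → R.mul (R.mul (R.mul t f) (R.star t)) f ≠ R.zero

/-- The inverse semigroup is closed. -/
def Closed : Prop :=
  ∀ t, R.dom t → ∃ F : Finset T, ↑F ⊆ R.TrivFix t ∧ ∀ e ∈ R.TrivFix t, R.Covers ↑F e

/-- The inverse semigroup is topologically free. -/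
def TopFree : Prop :=
  ∀ t e, R.dom t → R.NzIdem e → R.FixedBy e t → ∃ f ∈ R.TrivFix t, R.mul f e ≠ R.zero

/-- The inverse semigroup is effective. -/
def Effective : Prop :=
  ∀ t e, R.dom t → R.NzIdem e → R.FixedBy e t →
    ∃ F : Finset T, ↑F ⊆ R.TrivFix t ∧ R.Covers (↑F) e

/-- The inverse semigroup is minimal. -/
def Minimal : Prop :=
  ∀ e f, R.NzIdem e → R.NzIdem f → ∃ Ts : Finset T, (∀ t ∈ Ts, R.dom t) ∧
    R.Covers ((fun t => R.mul (R.mul t f) (R.star t)) '' ↑Ts) e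

/-- The inverse semigroup is quasi-fundamental. -/
def QuasiFund : Prop :=
  ∀ s t, R.dom s → R.dom t → s ≠ R.zero → t ≠ R.zero →
    (∀ e, R.NzIdem e → R.mul (R.mul s e) (R.star s) = R.mul (R.mul t e) (R.star t)) →
    ∃ u, R.dom u ∧ u ≠ R.zero ∧ R.le u s ∧ R.le u t

/-- The inverse semigroup is fundamental. -/
def Fund : Prop :=
  ∀ s t, R.dom s → R.dom t →
    (∀ e, R.NzIdem e → R.mul (R.mul s e) (R.star s) = R.mul (R.mul t e) (R.star t)) → s = t

/-- The inverse semigroup is `E*`-unitary. -/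
def EUnitary : Prop := ∀ t e, R.dom t → R.NzIdem e → R.le e t → R.mul t t = t

/-- The inverse semigroup is locally contracting. -/
def LocContr : Prop :=
  ∀ e, R.NzIdem e → ∃ s, R.dom s ∧ ∃ F : Finset T, ∃ f₀ ∈ F,
    (∀ f ∈ F, R.NzIdem f ∧ R.le f (R.mul e (R.mul (R.star s) s))) ∧
    ∀ f ∈ F, R.Covers (↑F) (R.mul (R.mul s f) (R.star s)) ∧
      R.mul f₀ (R.mul (R.mul s f) (R.star s)) = R.zero

/-- The inverse semigroup is strongly locally contracting. -/
def StrLocContr : Prop :=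
  ∀ e, R.NzIdem e → ∃ s f₀ f₁, R.dom s ∧ R.NzIdem f₀ ∧ R.NzIdem f₁ ∧
    R.le f₀ f₁ ∧ R.le f₁ (R.mul e (R.mul (R.star s) s)) ∧
    R.le (R.mul (R.mul s f₁) (R.star s)) f₁ ∧
    R.mul f₀ (R.mul (R.mul s f₁) (R.star s)) = R.zero

end RawSem

/-- A self-similar action `(G, E)` of a discrete groupoid `G` on a directed graph `E`
sharing the vertex/unit set `V`, encoded by total operations together with axioms
that hold on composable inputs.  Arrows `g` have source `gs g` and range `gr g`;
edges `e` have source `es e` and range `er e`; `g · e` (written `act g e`) and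
`g |_e` (written `res g e`) are meaningful when `gs g = er e`. -/
structure SSA where
  V : Type
  G : Type
  E : Type
  gs : G → V
  gr : G → V
  es : E → V
  er : E → V
  one : V → G
  mul : G → G → G
  inv : G → G
  act : G → E → E
  res : G → E → G
  gs_one : ∀ v, gs (one v) = v
  gr_one : ∀ v, gr (one v) = v
  gs_mul : ∀ g h, gs g = gr h → gs (mul g h) = gs h
  gr_mul : ∀ g h, gs g = gr h → gr (mul g h) = gr g
  mul_assoc' : ∀ g h k, gs g = gr h → gs h = gr k → mul (mul g h) k = mul g (mul h k)
  one_mul' : ∀ g, mul (one (gr g)) g = g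
  mul_one' : ∀ g, mul g (one (gs g)) = g
  gs_inv : ∀ g, gs (inv g) = gr g
  gr_inv : ∀ g, gr (inv g) = gs g
  mul_inv' : ∀ g, mul g (inv g) = one (gr g)
  inv_mul' : ∀ g, mul (inv g) g = one (gs g)
  er_act : ∀ g e, gs g = er e → er (act g e) = gr g
  act_one : ∀ e, act (one (er e)) e = e
  act_mul : ∀ g h e, gs g = gr h → gs h = er e → act (mul g h) e = act g (act h e)
  gs_res : ∀ g e, gs g = er e → gs (res g e) = es e
  gr_res : ∀ g e, gs g = er e → gr (res g e) = es (act g e)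
  res_mul : ∀ g h e, gs g = gr h → gs h = er e →
    res (mul g h) e = mul (res g (act h e)) (res h e)

namespace SSA

/-- Finite paths in the graph: `Pth S a b` is the type of paths with range `a`
and source `b`; `cons e p` is the path `e · p`. -/
inductive Pth (S : SSA) : S.V → S.V → Type
  | nil (v : S.V) : Pth S v v
  | cons (e : S.E) {b : S.V} (p : Pth S (S.es e) b) : Pth S (S.er e) b

/-- The path category `E^*`, bundled: a finite path with its range and source. -/
structure Path (S : SSA) where
  rng : S.V
  src : S.V
  pth : S.Pth rng src

/-- Infinite paths: sequences of edges `e₁e₂⋯` with `es eᵢ = er e_{i+1}`. -/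
structure InfPath (S : SSA) where
  seq : ℕ → S.E
  chain : ∀ n, S.es (seq n) = S.er (seq (n + 1))

/-- A twist `σ = (σ_G, σ_⋈)` of the self-similar action, with values in the
unit circle `𝕋 ⊆ ℂ`. -/
structure Twist (S : SSA) where
  σG : S.G → S.G → ℂ
  σB : S.G → S.E → ℂ
  σG_unimod : ∀ g h, S.gs g = S.gr h → ‖σG g h‖ = 1
  σB_unimod : ∀ g e, S.gs g = S.er e → ‖σB g e‖ = 1
  σG_cocycle : ∀ g h k, S.gs g = S.gr h → S.gs h = S.gr k →
    σG g h * σG (S.mul g h) k = σG h k * σG g (S.mul h k)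
  σG_one_left : ∀ g, σG (S.one (S.gr g)) g = 1
  σG_one_right : ∀ g, σG g (S.one (S.gs g)) = 1
  σB_one : ∀ e, σB (S.one (S.er e)) e = 1
  σB_cocycle : ∀ g h e, S.gs g = S.gr h → S.gs h = S.er e →
    σB h e * (starRingEnd ℂ) (σB (S.mul g h) e) * σB g (S.act h e) =
      (starRingEnd ℂ) (σG (S.res g (S.act h e)) (S.res h e)) * σG g h

variable {S : SSA}

namespace Pth

def length : ∀ {a b : S.V}, S.Pth a b → ℕ
  | _, _, .nil _ => 0
  | _, _, .cons _ p => length p + 1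

def toList : ∀ {a b : S.V}, S.Pth a b → List S.E
  | _, _, .nil _ => []
  | _, _, .cons e p => e :: toList p

def comp : ∀ {a b c : S.V}, S.Pth a b → S.Pth b c → S.Pth a c
  | _, _, _, .nil _, q => q
  | _, _, _, .cons e p, q => .cons e (comp p q)

end Pth

def Path.length (p : Path S) : ℕ := p.pth.length

def Path.toList (p : Path S) : List S.E := p.pth.toList

/-- A vertex regarded as a path of length `0`. -/
def Path.vert (S : SSA) (v : S.V) : Path S := ⟨v, v, .nil v⟩

/-- An edge regarded as a path of length `1`. -/
def Path.ofEdge (S : SSA) (e : S.E) : Path S := ⟨S.er e, S.es e, .cons e (.nil (S.es e))⟩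

/-- Concatenation of paths (junk -- the first path -- when not composable). -/
def Path.comp (p q : Path S) : Path S :=
  if h : p.src = q.rng then
    ⟨p.rng, q.src, Pth.comp (cast (congrArg (S.Pth p.rng) h) p.pth) q.pth⟩
  else p

/-- `q` is a prefix of `p`, i.e. `p` extends `q`. -/
def IsPrefix (S : SSA) (q p : Path S) : Prop :=
  ∃ r : Path S, q.src = r.rng ∧ p = q.comp r

/-- Two paths are comparable if one is a prefix of the other. -/
def Comparable (S : SSA) (p q : Path S) : Prop := IsPrefix S p q ∨ IsPrefix S q p

/-- The extended left action of groupoid arrows on finite paths,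
given by the recursive recipe `g · v = r g`, `g · (e μ) = (g · e) (g|_e · μ)`. -/
def pactAux (S : SSA) : ∀ {a b : S.V}, S.G → S.Pth a b → Path S
  | _, _, g, .nil _ => Path.vert S (S.gr g)
  | _, _, g, .cons e p => (Path.ofEdge S (S.act g e)).comp (pactAux S (S.res g e) p)

/-- The extended left action `g · μ` on finite paths. -/
def pact (S : SSA) (g : S.G) (p : Path S) : Path S := pactAux S g p.pth

/-- The extended restriction map, given by `g|_v = g` and `g|_{e μ} = (g|_e)|_μ`. -/
def presAux (S : SSA) : ∀ {a b : S.V}, S.G → S.Pth a b → S.G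
  | _, _, g, .nil _ => g
  | _, _, g, .cons e p => presAux S (S.res g e) p

/-- The extended restriction map `g |_μ` on finite paths. -/
def pres (S : SSA) (g : S.G) (p : Path S) : S.G := presAux S g p.pth

/-- `g` strongly fixes the path `p` : `g · p = p` and `g|_p = s p`. -/
def SFix (S : SSA) (g : S.G) (p : Path S) : Prop :=
  S.gs g = p.rng ∧ pact S g p = p ∧ pres S g p = S.one p.src

/-- `p` is a minimal strongly `g`-fixed path. -/
def MinSFix (S : SSA) (g : S.G) (p : Path S) : Prop :=
  SFix S g p ∧ ∀ q : Path S, IsPrefix S q p → q ≠ p → ¬ SFix S g q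

/-- `g` is a unit of the groupoid (an element of `G⁰`). -/
def IsUnitArrow (S : SSA) (g : S.G) : Prop := g = S.one (S.gs g)

/-- `g` fixes every path in `s(g)E^*`. -/
def FixesAll (S : SSA) (g : S.G) : Prop :=
  ∀ p : Path S, p.rng = S.gs g → pact S g p = p

/-- Condition (Fin): every `g` admits at most finitely many minimal strongly
`g`-fixed paths. -/
def CondFin (S : SSA) : Prop := ∀ g : S.G, {p : Path S | MinSFix S g p}.Finite

/-- Condition (Evr): if `g` fixes every path in `s(g)E^*` then `g` strongly fixes
some path in `s(g)E^*`. -/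
def CondEvr (S : SSA) : Prop := ∀ g : S.G, FixesAll S g → ∃ p : Path S, SFix S g p

/-- `p` is a `g`-cycle: a path of positive length with `g · s(p) = r(p)`. -/
def GCycle (S : SSA) (g : S.G) (p : Path S) : Prop :=
  1 ≤ p.length ∧ S.gs g = p.src ∧ S.gr g = p.rng

/-- The vertex `v` receives at least two distinct edges. -/
def HasEntranceVert (S : SSA) (v : S.V) : Prop :=
  ∃ e f : S.E, e ≠ f ∧ S.er e = v ∧ S.er f = v

/-- Base vertices of a finite path. -/
def Path.baseVerts (p : Path S) : Set S.V :=
  insert p.rng {v : S.V | ∃ e ∈ p.toList, S.es e = v}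

/-- A finite path has an entrance. -/
def Path.hasEntrance (p : Path S) : Prop := ∃ v ∈ p.baseVerts, HasEntranceVert S v

/-- Condition (Cyc): every `G`-cycle has an entrance. -/
def CondCyc (S : SSA) : Prop := ∀ (g : S.G) (p : Path S), GCycle S g p → p.hasEntrance

/-- `g` has slack. -/
def HasSlack (S : SSA) (g : S.G) : Prop :=
  ∃ F : Finset (Path S), (∀ p ∈ F, SFix S g p) ∧
    ∀ q : Path S, q.rng = S.gs g → ∃ p ∈ F, Comparable S p q

/-- Condition (Sla): if `g` fixes every path in `s(g)E^*` then `g` has slack. -/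
def CondSla (S : SSA) : Prop := ∀ g : S.G, FixesAll S g → HasSlack S g

def InfPath.rng (ξ : InfPath S) : S.V := S.er (ξ.seq 0)

/-- Base vertices of an infinite path. -/
def InfPath.baseVerts (ξ : InfPath S) : Set S.V := {v : S.V | ∃ n, S.er (ξ.seq n) = v}

/-- An infinite path has an entrance. -/
def InfPath.hasEntrance (ξ : InfPath S) : Prop := ∃ v ∈ ξ.baseVerts, HasEntranceVert S v

/-- The finite path `p` is a prefix of the infinite path `ξ`. -/
def PrefixOfInf (S : SSA) (p : Path S) (ξ : InfPath S) : Prop :=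
  p.rng = ξ.rng ∧ ∀ i : ℕ, i < p.length → p.toList[i]? = some (ξ.seq i)

/-- Finite or infinite paths. -/
abbrev GenPath (S : SSA) : Type := Path S ⊕ InfPath S

/-- The finite path `p` is a prefix of the finite or infinite path `ξ`. -/
def GPrefix (S : SSA) (p : Path S) : GenPath S → Prop
  | .inl q => IsPrefix S p q
  | .inr ξ => PrefixOfInf S p ξ

/-- The set `vE¹` of edges received by the vertex `v`. -/
def recvSet (S : SSA) (v : S.V) : Set S.E := {e : S.E | S.er e = v}

/-- A vertex is singular if it is a source or an infinite receiver. -/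
def Singular (S : SSA) (v : S.V) : Prop := recvSet S v = ∅ ∨ (recvSet S v).Infinite

/-- A vertex is regular if it is not singular. -/
def Regular (S : SSA) (v : S.V) : Prop := ¬ Singular S v

/-- The preorder `v ≪ w`: there is `v'` with `vE^*v' ≠ ∅` and `v'Gw ≠ ∅`. -/
def ll (S : SSA) (v w : S.V) : Prop :=
  ∃ (p : Path S) (g : S.G), p.rng = v ∧ S.gr g = p.src ∧ S.gs g = w

/-- Cofinality of the self-similar action: for every boundary path (a finite path
with singular source, or an infinite path) and every vertex `v`, some base vertex
`w` of the path satisfies `v ≪ w`. -/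
def Cofinal (S : SSA) : Prop :=
  (∀ p : Path S, Singular S p.src → ∀ v : S.V, ∃ w ∈ p.baseVerts, ll S v w) ∧
  (∀ ξ : InfPath S, ∀ v : S.V, ∃ w ∈ ξ.baseVerts, ll S v w)

def Hereditary (S : SSA) (W : Set S.V) : Prop :=
  ∀ v ∈ W, ∀ p : Path S, p.rng = v → p.src ∈ W

def Saturated (S : SSA) (W : Set S.V) : Prop :=
  ∀ w : S.V, Regular S w → (∀ e : S.E, S.er e = w → S.es e ∈ W) → w ∈ W

def GInvariant (S : SSA) (W : Set S.V) : Prop := ∀ g : S.G, S.gs g ∈ W → S.gr g ∈ W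

/-- `(G,E)`-invariant subsets of `E⁰`: `G`-invariant, hereditary and saturated. -/
def SSAInvariant (S : SSA) (W : Set S.V) : Prop :=
  GInvariant S W ∧ Hereditary S W ∧ Saturated S W

/-- Condition (Con): every vertex is reachable from a `G`-cycle with an entrance. -/
def CondCon (S : SSA) : Prop :=
  ∀ v : S.V, ∃ p : Path S, p.rng = v ∧
    ∃ (g : S.G) (c : Path S), GCycle S g c ∧ c.hasEntrance ∧ p.src ∈ c.baseVerts

/-- The underlying set (with zero `none`) of the inverse semigroup `S(G,E)`. -/
abbrev SGE (S : SSA) : Type := Option (Path S × S.G × Path S)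

/-- Well-formedness of a triple `(α, g, β)` : `r g = s α` and `s g = s β`. -/
def SGE.wf (S : SSA) : SGE S → Prop
  | none => True
  | some (α, g, β) => S.gr g = α.src ∧ S.gs g = β.src

/-- The idempotent `f_α = (α, s α, α)`. -/
def fIdem (S : SSA) (α : Path S) : SGE S := some (α, S.one α.src, α)

/-- The involution `(α,g,β)* = (β,g⁻¹,α)` on `S(G,E)`. -/
def sgeStar (S : SSA) : SGE S → SGE S
  | none => none
  | some (α, g, β) => some (β, S.inv g, α)

/-- The multiplication of the inverse semigroup `S(G,E)`. -/
def sgeMul (S : SSA) : SGE S → SGE S → SGE S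
  | none, _ => none
  | some _, none => none
  | some (α, g, β), some (γ, h, δ) =>
    if SGE.wf S (some (α, g, β)) ∧ SGE.wf S (some (γ, h, δ)) then
      if h1 : ∃ β' : Path S, β.src = Path.rng β' ∧ γ = β.comp β' then
        some (α.comp (pact S g h1.choose), S.mul (pres S g h1.choose) h, δ)
      else if h2 : ∃ γ' : Path S, γ.src = Path.rng γ' ∧ β = γ.comp γ' then
        some (α, S.mul g (S.inv (pres S (S.inv h) h2.choose)),
          δ.comp (pact S (S.inv h) h2.choose))
      else none
    else none

/-- Membership in the subsemigroup `S₀(G,E)` (with zero): triples with `|α| = |β|`. -/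
def domS0 (S : SSA) (x : SGE S) : Prop :=
  SGE.wf S x ∧ (x = none ∨ ∃ (α : Path S) (g : S.G) (β : Path S),
    x = some (α, g, β) ∧ α.length = β.length)

/-- Membership in the subsemigroup `S₀₀(G,E)` (with zero): triples `(g·β, g|_β, β)`. -/
def domS00 (S : SSA) (x : SGE S) : Prop :=
  SGE.wf S x ∧ (x = none ∨ ∃ (g : S.G) (β : Path S),
    S.gs g = β.rng ∧ x = some (pact S g β, pres S g β, β))

/-- `S(G,E)` as raw inverse-semigroup data. -/
def sgeSem (S : SSA) : RawSem (SGE S) := ⟨sgeMul S, sgeStar S, none, SGE.wf S⟩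

/-- `S₀(G,E)` as raw inverse-semigroup data. -/
def sgeSem0 (S : SSA) : RawSem (SGE S) := ⟨sgeMul S, sgeStar S, none, domS0 S⟩

/-- `S₀₀(G,E)` as raw inverse-semigroup data. -/
def sgeSem00 (S : SSA) : RawSem (SGE S) := ⟨sgeMul S, sgeStar S, none, domS00 S⟩

/-- The inductive extension of `σ_⋈` to finite paths:
`σ_⋈(h, s h) = 1`, `σ_⋈(h, e μ) = σ_⋈(h, e) σ_⋈(h|_e, μ)`. -/
def twAux (S : SSA) (σB : S.G → S.E → ℂ) : ∀ {a b : S.V}, S.G → S.Pth a b → ℂ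
  | _, _, _, .nil _ => 1
  | _, _, g, .cons e p => σB g e * twAux S σB (S.res g e) p

/-- The extension `σ_⋈ : G * E^* → 𝕋` of a twist to finite paths. -/
def twP (S : SSA) (σB : S.G → S.E → ℂ) (g : S.G) (p : Path S) : ℂ := twAux S σB g p.pth

/-- The `2`-cocycle `ω_σ` on `S(G,E)` induced by a twist `σ` of `(G,E)`. -/
def omg (S : SSA) (T : Twist S) : SGE S → SGE S → ℂ := fun x y =>
  match x, y with
  | some (_, g, β), some (γ, h, _) =>
    if h1 : ∃ β' : Path S, β.src = Path.rng β' ∧ γ = β.comp β' then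
      twP S T.σB g h1.choose * T.σG (pres S g h1.choose) h
    else if h2 : ∃ γ' : Path S, γ.src = Path.rng γ' ∧ β = γ.comp γ' then
      T.σG g (S.inv (pres S (S.inv h) h2.choose)) * twP S T.σB h (pact S (S.inv h) h2.choose)
    else 1
  | _, _ => 1

end SSA

namespace SSA

variable {S : SSA}

theorem inv_unique {g h : S.G} (hgh : S.gs g = S.gr h) (h1 : S.mul g h = S.one (S.gs h)) :
    g = S.inv h := by
  have e1 : S.mul (S.mul g h) (S.inv h) = S.mul g (S.mul h (S.inv h)) :=
    S.mul_assoc' g h (S.inv h) hgh (S.gr_inv h).symm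
  rw [S.mul_inv', ← hgh, S.mul_one', h1, ← S.gr_inv h, S.one_mul'] at e1
  exact e1.symm

theorem inv_inv' (g : S.G) : S.inv (S.inv g) = g := by
  refine (inv_unique (S.gr_inv g).symm ?_).symm
  rw [S.mul_inv', S.gs_inv]

theorem one_mul_one (v : S.V) : S.mul (S.one v) (S.one v) = S.one v := by
  have := S.one_mul' (S.one v)
  rwa [S.gr_one] at this

theorem inv_one' (v : S.V) : S.inv (S.one v) = S.one v := by
  refine (inv_unique ?_ ?_).symm
  · rw [S.gs_one, S.gr_one]
  · rw [one_mul_one, S.gs_one]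

theorem mul_one_eq (g : S.G) (v : S.V) (h : S.gs g = v) : S.mul g (S.one v) = g := by
  subst h; exact S.mul_one' g

theorem one_mul_eq (g : S.G) (v : S.V) (h : S.gr g = v) : S.mul (S.one v) g = g := by
  subst h; exact S.one_mul' g

theorem idem_eq_one {g : S.G} (hg : S.gs g = S.gr g) (h : S.mul g g = g) :
    g = S.one (S.gs g) := by
  have e1 := S.mul_assoc' g g (S.inv g) hg (S.gr_inv g).symm
  rw [h, S.mul_inv', ← hg, S.mul_one'] at e1
  exact e1.symm

theorem res_one (e : S.E) : S.res (S.one (S.er e)) e = S.one (S.es e) := by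
  have h0 : S.gs (S.one (S.er e)) = S.er e := S.gs_one _
  have e1 := S.res_mul (S.one (S.er e)) (S.one (S.er e)) e
    (by rw [S.gs_one, S.gr_one]) h0
  rw [one_mul_one, S.act_one] at e1
  have e2 := idem_eq_one (g := S.res (S.one (S.er e)) e)
    (by rw [S.gs_res _ _ h0, S.gr_res _ _ h0, S.act_one]) e1.symm
  rw [S.gs_res _ _ h0] at e2
  exact e2

/-! ### Path algebra -/

@[simp] theorem vert_rng (v : S.V) : (Path.vert S v).rng = v := rfl
@[simp] theorem vert_src (v : S.V) : (Path.vert S v).src = v := rfl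
@[simp] theorem vert_toList (v : S.V) : (Path.vert S v).toList = [] := rfl
@[simp] theorem ofEdge_rng (e : S.E) : (Path.ofEdge S e).rng = S.er e := rfl
@[simp] theorem ofEdge_src (e : S.E) : (Path.ofEdge S e).src = S.es e := rfl
@[simp] theorem ofEdge_toList (e : S.E) : (Path.ofEdge S e).toList = [e] := rfl

theorem Pth.toList_comp : ∀ {a b c : S.V} (p : S.Pth a b) (q : S.Pth b c),
    (p.comp q).toList = p.toList ++ q.toList
  | _, _, _, .nil _, q => rfl
  | _, _, _, .cons e p, q => by
    simp only [Pth.comp, Pth.toList, List.cons_append]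
    rw [Pth.toList_comp p q]

theorem Pth.length_eq : ∀ {a b : S.V} (p : S.Pth a b), p.length = p.toList.length
  | _, _, .nil _ => rfl
  | _, _, .cons e p => by
    simp only [Pth.length, Pth.toList, List.length_cons]
    rw [Pth.length_eq p]

theorem length_eq (p : Path S) : p.length = p.toList.length := Pth.length_eq p.pth

@[simp] theorem comp_rng (p q : Path S) : (p.comp q).rng = p.rng := by
  unfold Path.comp; split <;> rfl

theorem comp_src {p q : Path S} (h : p.src = q.rng) : (p.comp q).src = q.src := by
  unfold Path.comp; rw [dif_pos h]

theorem comp_toList {p q : Path S} (h : p.src = q.rng) :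
    (p.comp q).toList = p.toList ++ q.toList := by
  obtain ⟨a, b, p⟩ := p
  obtain ⟨c, d, q⟩ := q
  dsimp only at h
  subst h
  unfold Path.comp
  rw [dif_pos rfl]
  exact Pth.toList_comp p q

theorem ofEdge_comp_mk (e : S.E) {b : S.V} (p : S.Pth (S.es e) b) :
    (Path.ofEdge S e).comp ⟨S.es e, b, p⟩ = ⟨S.er e, b, .cons e p⟩ :=
  dif_pos rfl

theorem path_ind {P : Path S → Prop} (h0 : ∀ v, P (Path.vert S v))
    (h1 : ∀ e (p : Path S), S.es e = p.rng → P p → P ((Path.ofEdge S e).comp p)) :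
    ∀ p, P p := by
  rintro ⟨a, b, p⟩
  induction p with
  | nil v => exact h0 v
  | cons e p ih =>
    have := h1 e ⟨_, _, p⟩ rfl ih
    rw [ofEdge_comp_mk] at this
    exact this

theorem path_ext : ∀ {p q : Path S}, p.rng = q.rng → p.toList = q.toList → p = q := by
  intro p
  induction p using path_ind with
  | h0 v =>
    intro q
    induction q using path_ind with
    | h0 w => intro h _; simp only [vert_rng] at h; rw [h]
    | h1 e q h ih => intro _ h2; rw [comp_toList h] at h2; simp at h2
  | h1 e p h ih =>
    intro q
    induction q using path_ind with
    | h0 w => intro _ h2; rw [comp_toList h] at h2; simp at h2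
    | h1 f q h' _ =>
      intro _ h2
      rw [comp_toList h, comp_toList h'] at h2
      simp only [ofEdge_toList, List.cons_append, List.nil_append, List.cons.injEq] at h2
      obtain ⟨rfl, h2⟩ := h2
      rw [ih (h.symm.trans h') h2]

theorem comp_vert {p : Path S} {v : S.V} (h : p.src = v) : p.comp (Path.vert S v) = p := by
  apply path_ext
  · simp
  · rw [comp_toList (by simpa using h)]; simp

theorem vert_comp {p : Path S} {v : S.V} (h : v = p.rng) : (Path.vert S v).comp p = p := by
  apply path_ext
  · simpa using h
  · rw [comp_toList (by simpa using h)]; simp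

theorem comp_assoc {p q r : Path S} (h : p.src = q.rng) (h' : q.src = r.rng) :
    (p.comp q).comp r = p.comp (q.comp r) := by
  apply path_ext
  · simp
  · rw [comp_toList (by rwa [comp_src h]), comp_toList h, comp_toList (by simpa using h),
      comp_toList h', List.append_assoc]

theorem comp_cancel {p q r : Path S} (h : p.src = q.rng) (h' : p.src = r.rng)
    (he : p.comp q = p.comp r) : q = r := by
  apply path_ext (h.symm.trans h')
  have := congrArg Path.toList he
  rw [comp_toList h, comp_toList h'] at this
  exact List.append_cancel_left this

theorem eq_vert_of_toList {p : Path S} (h : p.toList = []) : p = Path.vert S p.rng :=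
  path_ext rfl (by simpa using h)

theorem comp_eq_self {p q : Path S} (h : p.src = q.rng) (he : p.comp q = p) :
    q = Path.vert S p.src := by
  rw [h]
  apply eq_vert_of_toList
  have := congrArg Path.toList he
  rw [comp_toList h] at this
  simpa using this

/-- Splitting a path according to a splitting of its edge list. -/
theorem path_split : ∀ (p : Path S) (l m : List S.E), p.toList = l ++ m →
    ∃ q r : Path S, q.src = r.rng ∧ p = q.comp r ∧ q.toList = l ∧ r.toList = m := by
  intro p
  induction p using path_ind with
  | h0 v =>
    intro l m h
    simp only [vert_toList] at h
    obtain ⟨rfl, rfl⟩ := List.append_eq_nil_iff.1 h.symm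
    exact ⟨Path.vert S v, Path.vert S v, rfl, (comp_vert rfl).symm, rfl, rfl⟩
  | h1 e p h ih =>
    intro l m hl
    cases l with
    | nil => exact ⟨Path.vert S (S.er e), (Path.ofEdge S e).comp p, by simp,
        (vert_comp (by simp)).symm, rfl, by simpa using hl⟩
    | cons f l =>
      rw [comp_toList h] at hl
      simp only [ofEdge_toList, List.cons_append, List.nil_append, List.cons.injEq] at hl
      obtain ⟨rfl, hl⟩ := hl
      obtain ⟨q, r, h1, rfl, h2, h3⟩ := ih l m hl
      have h' : (Path.ofEdge S e).src = q.rng := by simpa using h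
      refine ⟨(Path.ofEdge S e).comp q, r, ?_, ?_, ?_, h3⟩
      · rw [comp_src h', h1]
      · rw [comp_assoc h' h1]
      · rw [comp_toList h', h2]; rfl

theorem isPrefix_iff (q p : Path S) :
    IsPrefix S q p ↔ q.rng = p.rng ∧ q.toList <+: p.toList := by
  constructor
  · rintro ⟨r, h, rfl⟩
    refine ⟨by simp, ?_⟩
    rw [comp_toList h]
    exact List.prefix_append _ _
  · rintro ⟨h, m, hm⟩
    obtain ⟨q', r, h1, rfl, h2, -⟩ := path_split p _ _ hm.symm
    have : q = q' := path_ext (by simpa using h) h2.symm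
    subst this
    exact ⟨r, h1, rfl⟩

theorem isPrefix_refl (p : Path S) : IsPrefix S p p := (isPrefix_iff _ _).2 ⟨rfl, List.prefix_rfl⟩

theorem isPrefix_comp {p q : Path S} (h : p.src = q.rng) : IsPrefix S p (p.comp q) := ⟨q, h, rfl⟩

theorem isPrefix_trans {p q r : Path S} (h : IsPrefix S p q) (h' : IsPrefix S q r) :
    IsPrefix S p r := by
  rw [isPrefix_iff] at *
  exact ⟨h.1.trans h'.1, h.2.trans h'.2⟩

theorem comparable_symm {p q : Path S} (h : Comparable S p q) : Comparable S q p := Or.symm h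

theorem comparable_of_prefix {p q r : Path S} (h : IsPrefix S p r) (h' : IsPrefix S q r) :
    Comparable S p q := by
  unfold Comparable
  rw [isPrefix_iff] at *
  rcases List.prefix_or_prefix_of_prefix h.2 h'.2 with h2 | h2
  · exact Or.inl ⟨h.1.trans h'.1.symm, h2⟩
  · right; rw [isPrefix_iff]; exact ⟨h'.1.trans h.1.symm, h2⟩

theorem isPrefix_comp_left {p q r : Path S} (h : p.src = q.rng) (h' : p.src = r.rng) :
    IsPrefix S (p.comp q) (p.comp r) ↔ IsPrefix S q r := by
  rw [isPrefix_iff, isPrefix_iff, comp_toList h, comp_toList h', List.prefix_append_right_inj]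
  simp [← h, ← h']

theorem comparable_comp_left {p q r : Path S} (h : p.src = q.rng) (h' : p.src = r.rng) :
    Comparable S (p.comp q) (p.comp r) ↔ Comparable S q r := by
  unfold Comparable
  rw [isPrefix_comp_left h h', isPrefix_comp_left h' h]

theorem comparable_prefix {p q : Path S} (h : Comparable S p q) (hl : p.length ≤ q.length) :
    IsPrefix S p q := by
  rcases h with h | h
  · exact h
  · rw [isPrefix_iff] at h
    rw [length_eq, length_eq] at hl
    rw [path_ext h.1 (h.2.eq_of_length_le hl)]
    exact isPrefix_refl _

theorem comparable_eq {p q : Path S} (h : Comparable S p q) (hl : p.length = q.length) :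
    p = q := by
  have := comparable_prefix h hl.le
  rw [isPrefix_iff] at this
  rw [length_eq, length_eq] at hl
  exact path_ext this.1 (this.2.eq_of_length hl)

theorem length_comp {p q : Path S} (h : p.src = q.rng) :
    (p.comp q).length = p.length + q.length := by
  simp only [length_eq, comp_toList h, List.length_append]

/-! ### The extended action -/

@[simp] theorem pact_vert (g : S.G) (v : S.V) : pact S g (Path.vert S v) = Path.vert S (S.gr g) := rfl
@[simp] theorem pres_vert (g : S.G) (v : S.V) : pres S g (Path.vert S v) = g := rfl

theorem pact_cons (g : S.G) (e : S.E) (p : Path S) (h : S.es e = p.rng) :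
    pact S g ((Path.ofEdge S e).comp p) =
      (Path.ofEdge S (S.act g e)).comp (pact S (S.res g e) p) := by
  obtain ⟨a, b, p⟩ := p
  dsimp only at h
  subst h
  rw [ofEdge_comp_mk]
  rfl

theorem pres_cons (g : S.G) (e : S.E) (p : Path S) (h : S.es e = p.rng) :
    pres S g ((Path.ofEdge S e).comp p) = pres S (S.res g e) p := by
  obtain ⟨a, b, p⟩ := p
  dsimp only at h
  subst h
  rw [ofEdge_comp_mk]
  rfl

theorem act_basic (p : Path S) : ∀ g : S.G, S.gs g = p.rng →
    (pact S g p).rng = S.gr g ∧ (pact S g p).src = S.gr (pres S g p) ∧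
    S.gs (pres S g p) = p.src ∧ (pact S g p).length = p.length := by
  induction p using path_ind with
  | h0 v => intro g h; exact ⟨rfl, rfl, h, rfl⟩
  | h1 e p he ih =>
    intro g h
    have h : S.gs g = S.er e := by simpa using h
    have h2 : S.gs (S.res g e) = p.rng := by rw [S.gs_res _ _ h, he]
    obtain ⟨i1, i2, i3, i4⟩ := ih _ h2
    have h3 : (Path.ofEdge S (S.act g e)).src = (pact S (S.res g e) p).rng := by
      rw [i1, S.gr_res _ _ h]; rfl
    rw [pact_cons _ _ _ he, pres_cons _ _ _ he]
    refine ⟨by simpa using S.er_act _ _ h, ?_, ?_, ?_⟩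
    · rw [comp_src h3, i2]
    · rw [comp_src (by simpa using he), i3]
    · rw [length_comp h3, length_comp (by simpa using he), i4]; rfl

theorem pact_rng {g : S.G} {p : Path S} (h : S.gs g = p.rng) : (pact S g p).rng = S.gr g :=
  (act_basic p g h).1
theorem pact_src {g : S.G} {p : Path S} (h : S.gs g = p.rng) :
    (pact S g p).src = S.gr (pres S g p) := (act_basic p g h).2.1
theorem gs_pres {g : S.G} {p : Path S} (h : S.gs g = p.rng) : S.gs (pres S g p) = p.src :=
  (act_basic p g h).2.2.1
theorem pact_length {g : S.G} {p : Path S} (h : S.gs g = p.rng) :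
    (pact S g p).length = p.length := (act_basic p g h).2.2.2

theorem pact_comp (p : Path S) : ∀ (g : S.G) (q : Path S), S.gs g = p.rng → p.src = q.rng →
    pact S g (p.comp q) = (pact S g p).comp (pact S (pres S g p) q) ∧
    pres S g (p.comp q) = pres S (pres S g p) q := by
  induction p using path_ind with
  | h0 v =>
    intro g q h h'
    have hv : v = q.rng := by simpa using h'
    have hg : S.gs g = q.rng := by rw [← hv]; exact h
    rw [vert_comp hv, pact_vert, pres_vert, vert_comp (pact_rng hg).symm]
    exact ⟨rfl, rfl⟩
  | h1 e p he ih =>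
    intro g q h h'
    have h : S.gs g = S.er e := by simpa using h
    have he' : (Path.ofEdge S e).src = p.rng := by simpa using he
    have h2 : S.gs (S.res g e) = p.rng := by rw [S.gs_res _ _ h, he]
    rw [comp_src he'] at h'
    have h3 : (Path.ofEdge S (S.act g e)).src = (pact S (S.res g e) p).rng := by
      rw [pact_rng h2, S.gr_res _ _ h]; rfl
    obtain ⟨i1, i2⟩ := ih _ q h2 h'
    have h4 : S.gs (pres S (S.res g e) p) = q.rng := by rw [gs_pres h2, h']
    rw [comp_assoc he' h', pact_cons _ _ (p.comp q) (by simpa using he),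
      pres_cons _ _ (p.comp q) (by simpa using he),
      pact_cons _ _ _ he, pres_cons _ _ _ he, i1, i2,
      comp_assoc h3 (by rw [pact_src h2, pact_rng h4])]
    exact ⟨rfl, rfl⟩

theorem pact_one (p : Path S) : ∀ v, v = p.rng →
    pact S (S.one v) p = p ∧ pres S (S.one v) p = S.one p.src := by
  induction p using path_ind with
  | h0 v => rintro w rfl; simp [S.gr_one]
  | h1 e p he ih =>
    intro v hv
    have hv : v = S.er e := by simpa using hv
    subst hv
    rw [pact_cons _ _ _ he, pres_cons _ _ _ he, S.act_one, res_one, (ih _ he).1, (ih _ he).2,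
      comp_src (by simpa using he)]
    exact ⟨rfl, rfl⟩

theorem pact_mul (p : Path S) : ∀ g h : S.G, S.gs g = S.gr h → S.gs h = p.rng →
    pact S (S.mul g h) p = pact S g (pact S h p) ∧
    pres S (S.mul g h) p = S.mul (pres S g (pact S h p)) (pres S h p) := by
  induction p using path_ind with
  | h0 v => intro g h h1 h2; simp [S.gr_mul _ _ h1]
  | h1 e p he ih =>
    intro g h h1 h2
    have h2 : S.gs h = S.er e := by simpa using h2
    have h3 : S.gs (S.res h e) = p.rng := by rw [S.gs_res _ _ h2, he]
    have h4 : S.gs g = S.er (S.act h e) := by rw [S.er_act _ _ h2, h1]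
    have h5 : S.gs (S.res g (S.act h e)) = S.gr (S.res h e) := by
      rw [S.gs_res _ _ h4, S.gr_res _ _ h2]
    have h6 : S.es (S.act h e) = (pact S (S.res h e) p).rng := by
      rw [pact_rng h3, S.gr_res _ _ h2]
    rw [pact_cons _ _ _ he, pres_cons _ _ _ he, S.act_mul _ _ _ h1 h2, S.res_mul _ _ _ h1 h2,
      (ih _ _ h5 h3).1, (ih _ _ h5 h3).2, pact_cons _ _ _ he, pact_cons _ _ _ h6,
      pres_cons _ _ _ h6, pres_cons _ _ _ he]
    exact ⟨rfl, rfl⟩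

theorem pact_inv_pact {g : S.G} {p : Path S} (h : S.gs g = p.rng) :
    pact S (S.inv g) (pact S g p) = p := by
  rw [← (pact_mul p (S.inv g) g (S.gs_inv g) h).1, S.inv_mul', (pact_one p _ h).1]

end SSA

namespace SSA

variable {S : SSA}

/-! ### The product in `S(G,E)` -/

theorem mul_case1 {α β δ β' : Path S} {g h : S.G}
    (hg : S.gr g = α.src) (hg' : S.gs g = β.src) (hb : β.src = β'.rng)
    (hh : S.gr h = β'.src) (hh' : S.gs h = δ.src) :
    sgeMul S (some (α, g, β)) (some (β.comp β', h, δ)) =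
      some (α.comp (pact S g β'), S.mul (pres S g β') h, δ) := by
  have h1 : ∃ β'' : Path S, β.src = Path.rng β'' ∧ β.comp β' = β.comp β'' := ⟨β', hb, rfl⟩
  have h2 : h1.choose = β' := (comp_cancel hb h1.choose_spec.1 h1.choose_spec.2).symm
  have hwf : SGE.wf S (some (α, g, β)) ∧ SGE.wf S (some (β.comp β', h, δ)) :=
    ⟨⟨hg, hg'⟩, ⟨by rw [comp_src hb]; exact hh, hh'⟩⟩
  simp only [sgeMul]
  rw [if_pos hwf, dif_pos h1, h2]

theorem mul_case2 {α γ δ γ' : Path S} {g h : S.G}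
    (hg : S.gr g = α.src) (hg' : S.gs g = γ'.src) (hb : γ.src = γ'.rng)
    (hh : S.gr h = γ.src) (hh' : S.gs h = δ.src) :
    sgeMul S (some (α, g, γ.comp γ')) (some (γ, h, δ)) =
      some (α, S.mul g (S.inv (pres S (S.inv h) γ')), δ.comp (pact S (S.inv h) γ')) := by
  by_cases h1 : ∃ β' : Path S, (γ.comp γ').src = Path.rng β' ∧ γ = (γ.comp γ').comp β'
  · obtain ⟨β', e1, e2⟩ := h1
    have e3 : γ' = Path.vert S γ.src := by
      rw [hb]
      apply eq_vert_of_toList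
      have := congrArg Path.toList e2
      rw [comp_toList e1, comp_toList hb, List.append_assoc] at this
      have h3 := List.append_cancel_left ((List.append_nil _).trans this)
      exact (List.append_eq_nil_iff.1 h3.symm).1
    subst e3
    have := mul_case1 (α := α) (β := γ) (δ := δ) (β' := Path.vert S γ.src) (g := g) (h := h)
      hg hg' rfl hh hh'
    rw [comp_vert rfl] at this ⊢
    rw [this]
    simp only [pact_vert, pres_vert]
    rw [comp_vert hg.symm, inv_inv', S.gr_inv, comp_vert hh'.symm]
  · have h2 : ∃ γ'' : Path S, γ.src = Path.rng γ'' ∧ γ.comp γ' = γ.comp γ'' := ⟨γ', hb, rfl⟩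
    have h3 : h2.choose = γ' := (comp_cancel hb h2.choose_spec.1 h2.choose_spec.2).symm
    have hwf : SGE.wf S (some (α, g, γ.comp γ')) ∧ SGE.wf S (some (γ, h, δ)) :=
      ⟨⟨hg, by rw [comp_src hb]; exact hg'⟩, ⟨hh, hh'⟩⟩
    simp only [sgeMul]
    rw [if_pos hwf, dif_neg h1, dif_pos h2, h3]

theorem mul_ne_none_comparable {α β γ δ : Path S} {g h : S.G}
    (h0 : sgeMul S (some (α, g, β)) (some (γ, h, δ)) ≠ none) : Comparable S β γ := by
  by_contra hc
  apply h0
  have h1 : ¬ ∃ β' : Path S, β.src = Path.rng β' ∧ γ = β.comp β' := fun h => hc (Or.inl h)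
  have h2 : ¬ ∃ γ' : Path S, γ.src = Path.rng γ' ∧ β = γ.comp γ' := fun h => hc (Or.inr h)
  simp only [sgeMul]
  rw [dif_neg h1, dif_neg h2, ite_self]

theorem mul_ff_left {α α' : Path S} (h : α.src = α'.rng) :
    sgeMul S (fIdem S α) (fIdem S (α.comp α')) = fIdem S (α.comp α') := by
  unfold fIdem
  rw [comp_src h, mul_case1 (S.gr_one _) (S.gs_one _) h (S.gr_one _)
    ((S.gs_one _).trans (comp_src h).symm), (pact_one α' _ h).1, (pact_one α' _ h).2, one_mul_one]

theorem mul_ff_right {α α' : Path S} (h : α.src = α'.rng) :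
    sgeMul S (fIdem S (α.comp α')) (fIdem S α) = fIdem S (α.comp α') := by
  unfold fIdem
  rw [comp_src h, mul_case2 ((S.gr_one _).trans (comp_src h).symm) (S.gs_one _) h (S.gr_one _)
    (S.gs_one _), inv_one', (pact_one α' _ h).1, (pact_one α' _ h).2, inv_one', one_mul_one]

theorem mul_ff_ne (α β : Path S) :
    sgeMul S (fIdem S α) (fIdem S β) ≠ none ↔ Comparable S α β := by
  constructor
  · exact mul_ne_none_comparable
  · rintro (⟨r, h, rfl⟩ | ⟨r, h, rfl⟩)
    · rw [mul_ff_left h]; simp [fIdem]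
    · rw [mul_ff_right h]; simp [fIdem]

theorem mul_ff_self (α : Path S) : sgeMul S (fIdem S α) (fIdem S α) = fIdem S α := by
  have := mul_ff_left (α := α) (α' := Path.vert S α.src) rfl
  rwa [comp_vert rfl] at this

theorem fIdem_inj {α β : Path S} (h : fIdem S α = fIdem S β) : α = β := by
  simp only [fIdem, Option.some.injEq, Prod.mk.injEq] at h
  exact h.1

theorem nzIdem_iff (x : SGE S) : (sgeSem S).NzIdem x ↔ ∃ α, x = fIdem S α := by
  constructor
  · rintro ⟨h1, h2, h3⟩
    change SGE.wf S x at h1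
    change sgeMul S x x = x at h2
    change x ≠ none at h3
    rcases x with _ | ⟨α, g, β⟩
    · exact absurd rfl h3
    obtain ⟨hg, hg'⟩ := h1
    have hc : Comparable S β α := mul_ne_none_comparable (by rw [h2]; simp)
    rcases hc with ⟨r, hr, rfl⟩ | ⟨r, hr, rfl⟩
    · have hg2 := hg
      rw [comp_src hr] at hg2
      rw [mul_case1 hg hg' hr hg2 hg'] at h2
      simp only [Option.some.injEq, Prod.mk.injEq] at h2
      obtain ⟨e1, e2, -⟩ := h2
      have hgr : S.gs g = r.rng := hg'.trans hr
      have e3 := comp_eq_self (by rw [pact_rng hgr, hg]) e1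
      have e4 : r = Path.vert S r.rng := by
        apply eq_vert_of_toList
        rw [← List.length_eq_zero_iff, ← length_eq, ← pact_length hgr, e3]; rfl
      rw [← hr] at e4
      subst e4
      rw [comp_vert rfl] at *
      have e5 := idem_eq_one (hg'.trans hg.symm) (by simpa using e2)
      exact ⟨β, by unfold fIdem; rw [e5, hg']⟩
    · have hg2 := hg'
      rw [comp_src hr] at hg2
      rw [mul_case2 hg hg2 hr hg hg'] at h2
      simp only [Option.some.injEq, Prod.mk.injEq] at h2
      obtain ⟨-, e2, e1⟩ := h2
      have hgr : S.gs (S.inv g) = r.rng := by rw [S.gs_inv, hg, hr]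
      have e3 := comp_eq_self (by rw [pact_rng hgr, S.gr_inv, hg']) e1
      have e4 : r = Path.vert S r.rng := by
        apply eq_vert_of_toList
        rw [← List.length_eq_zero_iff, ← length_eq, ← pact_length hgr, e3]; rfl
      rw [← hr] at e4
      subst e4
      rw [comp_vert rfl] at *
      have e5 := idem_eq_one (hg'.trans hg.symm) (by simpa [inv_inv'] using e2)
      exact ⟨α, by rw [hg'] at e5; rw [e5]; rfl⟩
  · rintro ⟨α, rfl⟩
    exact ⟨⟨S.gr_one _, S.gs_one _⟩, mul_ff_self α, by simp [fIdem, sgeSem]⟩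

theorem star_f (α : Path S) : sgeStar S (fIdem S α) = fIdem S α := by
  simp [sgeStar, fIdem, inv_one']

theorem le_f_iff (γ : Path S) (t : SGE S) :
    (sgeSem S).le (fIdem S γ) t ↔ fIdem S γ = sgeMul S t (fIdem S γ) := by
  change fIdem S γ = sgeMul S t (sgeMul S (sgeStar S (fIdem S γ)) (fIdem S γ)) ↔ _
  rw [star_f, mul_ff_self]

theorem le_ff_iff (γ α : Path S) :
    (sgeSem S).le (fIdem S γ) (fIdem S α) ↔ IsPrefix S α γ := by
  rw [le_f_iff]
  constructor
  · intro h
    have hc : Comparable S α γ := (mul_ff_ne α γ).1 (by rw [← h]; simp [fIdem])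
    rcases hc with hc | ⟨r, hr, rfl⟩
    · exact hc
    · rw [mul_ff_right hr] at h
      rw [← fIdem_inj h]
      exact isPrefix_refl _
  · rintro ⟨r, hr, rfl⟩
    rw [mul_ff_left hr]

/-- Description of `F_t`. -/
theorem le_t_iff {α β γ : Path S} {g : S.G} (hg : S.gr g = α.src) (hg' : S.gs g = β.src) :
    (sgeSem S).le (fIdem S γ) (some (α, g, β)) ↔
      α = β ∧ ∃ β' : Path S, γ = β.comp β' ∧ SFix S g β' := by
  rw [le_f_iff]
  have key : ∀ r : Path S, β.src = r.rng →
      (fIdem S (β.comp r) = sgeMul S (some (α, g, β)) (fIdem S (β.comp r)) ↔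
        α = β ∧ SFix S g r) := by
    intro r hr
    have hgr : S.gs g = r.rng := hg'.trans hr
    unfold fIdem
    rw [mul_case1 hg hg' hr ((S.gr_one _).trans (comp_src hr)) (S.gs_one _)]
    rw [mul_one_eq _ _ (by rw [gs_pres hgr, comp_src hr]), comp_src hr]
    simp only [Option.some.injEq, Prod.mk.injEq, and_true]
    have hr2 : α.src = (pact S g r).rng := by rw [pact_rng hgr, hg]
    constructor
    · rintro ⟨e1, e2⟩
      have e3 := congrArg Path.toList e1
      rw [comp_toList hr, comp_toList hr2] at e3
      have e4 := List.append_inj' e3 (by rw [← length_eq, ← length_eq, pact_length hgr])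
      have e5 : β = α := path_ext (by simpa using congrArg Path.rng e1) e4.1
      subst e5
      exact ⟨rfl, hgr, (comp_cancel hr hr2 e1).symm, e2.symm⟩
    · rintro ⟨rfl, -, e1, e2⟩
      rw [e1, e2]
      exact ⟨rfl, rfl⟩
  constructor
  · intro h
    have hc : Comparable S β γ := mul_ne_none_comparable (α := α) (g := g) (h := S.one γ.src)
      (δ := γ) (by change sgeMul S _ (fIdem S γ) ≠ none; rw [← h]; simp [fIdem])
    rcases hc with ⟨r, hr, rfl⟩ | ⟨r, hr, rfl⟩
    · have := (key r hr).1 h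
      exact ⟨this.1, r, rfl, this.2⟩
    · have hg2 := hg'
      rw [comp_src hr] at hg2
      have h' := h
      unfold fIdem at h'
      rw [mul_case2 hg hg2 hr (S.gr_one _) (S.gs_one _), inv_one', (pact_one _ _ hr).1] at h'
      simp only [Option.some.injEq, Prod.mk.injEq] at h'
      have e3 := comp_eq_self hr h'.2.2.symm
      subst e3
      rw [comp_vert rfl] at *
      have := key (Path.vert S γ.src) rfl
      rw [comp_vert rfl] at this
      have := this.1 h
      exact ⟨this.1, Path.vert S γ.src, (comp_vert rfl).symm, this.2⟩
  · rintro ⟨e1, r, rfl, h⟩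
    exact (key r (by rw [← hg', h.1])).2 ⟨e1, h⟩

theorem conj_case1 {α β r : Path S} {g : S.G} (hg : S.gr g = α.src) (hg' : S.gs g = β.src)
    (hr : β.src = r.rng) :
    sgeMul S (sgeMul S (some (α, g, β)) (fIdem S (β.comp r))) (sgeStar S (some (α, g, β))) =
      fIdem S (α.comp (pact S g r)) := by
  have hgr : S.gs g = r.rng := hg'.trans hr
  have hr2 : α.src = (pact S g r).rng := by rw [pact_rng hgr, hg]
  unfold fIdem sgeStar
  rw [mul_case1 hg hg' hr ((S.gr_one _).trans (comp_src hr)) (S.gs_one _)]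
  rw [mul_one_eq _ _ (by rw [gs_pres hgr, comp_src hr])]
  dsimp only
  rw [mul_case2 (by rw [comp_src hr2, pact_src hgr]) (gs_pres hgr) hr
    (by rw [S.gr_inv, hg']) (by rw [S.gs_inv, hg]), inv_inv', S.mul_inv', comp_src hr2,
    pact_src hgr]

theorem conj_case2 {α γ r : Path S} {g : S.G} (hg : S.gr g = α.src)
    (hg' : S.gs g = (γ.comp r).src) (hr : γ.src = r.rng) :
    sgeMul S (sgeMul S (some (α, g, γ.comp r)) (fIdem S γ)) (sgeStar S (some (α, g, γ.comp r))) =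
      fIdem S α := by
  have hg2 := hg'
  rw [comp_src hr] at hg2
  unfold fIdem sgeStar
  rw [mul_case2 hg hg2 hr (S.gr_one _) (S.gs_one _), inv_one', (pact_one _ _ hr).1,
    (pact_one _ _ hr).2, inv_one', mul_one_eq _ _ hg2]
  dsimp only
  have := mul_case1 (α := α) (β := γ.comp r) (δ := α) (β' := Path.vert S (γ.comp r).src) (g := g)
    (h := S.inv g) hg hg' rfl (by rw [S.gr_inv, hg']; rfl) (by rw [S.gs_inv, hg])
  rw [comp_vert rfl] at this
  rw [this, pact_vert, pres_vert, comp_vert hg.symm, S.mul_inv', hg]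

/-- Reformulation of `t f t* f ≠ 0`. -/
theorem fixed_iff {α β γ : Path S} {g : S.G} (hg : S.gr g = α.src) (hg' : S.gs g = β.src) :
    (sgeMul S (sgeMul S (sgeMul S (some (α, g, β)) (fIdem S γ)) (sgeStar S (some (α, g, β))))
      (fIdem S γ) ≠ none) ↔
    Comparable S β γ ∧ (∀ r : Path S, β.src = r.rng → γ = β.comp r →
        Comparable S (α.comp (pact S g r)) γ) ∧
      (IsPrefix S γ β → Comparable S α γ) := by
  constructor
  · intro h
    have hc : Comparable S β γ := mul_ne_none_comparable (α := α) (g := g) (h := S.one γ.src)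
      (δ := γ) (by
        intro h0
        apply h
        change sgeMul S _ (fIdem S γ) = none at h0
        rw [h0]; rfl)
    refine ⟨hc, ?_, ?_⟩
    · rintro r hr rfl
      rw [conj_case1 hg hg' hr] at h
      exact (mul_ff_ne _ _).1 h
    · rintro ⟨r, hr, rfl⟩
      rw [conj_case2 hg hg' hr] at h
      exact (mul_ff_ne _ _).1 h
  · rintro ⟨⟨r, hr, rfl⟩ | ⟨r, hr, rfl⟩, h1, h2⟩
    · rw [conj_case1 hg hg' hr]
      exact (mul_ff_ne _ _).2 (h1 r hr rfl)
    · rw [conj_case2 hg hg' hr]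
      exact (mul_ff_ne _ _).2 (h2 (isPrefix_comp hr))

theorem fixedBy_iff {α β γ : Path S} {g : S.G} (hg : S.gr g = α.src) (hg' : S.gs g = β.src) :
    (sgeSem S).FixedBy (fIdem S γ) (some (α, g, β)) ↔
    ∀ γ' : Path S, IsPrefix S γ γ' →
      Comparable S β γ' ∧ (∀ r : Path S, β.src = r.rng → γ' = β.comp r →
        Comparable S (α.comp (pact S g r)) γ') ∧
      (IsPrefix S γ' β → Comparable S α γ') := by
  constructor
  · intro h γ' hγ
    exact (fixed_iff hg hg').1 (h (fIdem S γ') ((nzIdem_iff _).2 ⟨_, rfl⟩) ((le_ff_iff _ _).2 hγ))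
  · intro h f hf hle
    obtain ⟨γ', rfl⟩ := (nzIdem_iff _).1 hf
    exact (fixed_iff hg hg').2 (h γ' ((le_ff_iff _ _).1 hle))

end SSA

namespace SSA

variable {S : SSA}

/-! ### Consequences of (Cyc) -/

theorem take_pact {p p' : Path S} {g : S.G} {j : ℕ} (hg : S.gs g = p.rng) (hp : p.rng = p'.rng)
    (hj : j ≤ p.toList.length) (h : p.toList.take j = p'.toList.take j) :
    (pact S g p).toList.take j = (pact S g p').toList.take j := by
  obtain ⟨q, r, h1, h2, h3, -⟩ := path_split p _ _ (List.take_append_drop j p.toList).symm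
  obtain ⟨q', r', h1', h2', h3', -⟩ := path_split p' _ _ (List.take_append_drop j p'.toList).symm
  have hq : q.rng = p.rng := by rw [h2, comp_rng]
  have hq' : q'.rng = p'.rng := by rw [h2', comp_rng]
  have e : q = q' := path_ext (hq.trans (hp.trans hq'.symm)) (by rw [h3, h3', h])
  subst e
  have hgq : S.gs g = q.rng := hg.trans hq.symm
  have hlen : (pact S g q).toList.length = j := by
    rw [← length_eq, pact_length hgq, length_eq, h3, List.length_take, min_eq_left hj]
  have aux : ∀ r : Path S, q.src = r.rng →
      (pact S g (q.comp r)).toList.take j = (pact S g q).toList := by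
    intro r hr
    have hgr : S.gs (pres S g q) = r.rng := by rw [gs_pres hgq, hr]
    rw [(pact_comp q g r hgq hr).1, comp_toList (by rw [pact_src hgq, pact_rng hgr]),
      List.take_left' hlen]
  rw [h2, h2', aux r h1, aux r' h1']

theorem toList_singleton {p : Path S} {e : S.E} (h : p.toList = [e]) : p = Path.ofEdge S e := by
  induction p using path_ind with
  | h0 v => simp at h
  | h1 f p hf _ =>
    have hf' : (Path.ofEdge S f).src = p.rng := by simpa using hf
    rw [comp_toList hf'] at h
    simp only [ofEdge_toList, List.cons_append, List.nil_append, List.cons.injEq] at h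
    obtain ⟨rfl, h⟩ := h
    rw [eq_vert_of_toList h, comp_vert hf]

theorem baseVerts_split {p : Path S} {v : S.V} (h : v ∈ p.baseVerts) :
    ∃ q r : Path S, q.src = r.rng ∧ p = q.comp r ∧ q.src = v := by
  rcases h with rfl | ⟨e, he, rfl⟩
  · exact ⟨Path.vert S p.rng, p, rfl, (vert_comp rfl).symm, rfl⟩
  · obtain ⟨l, m, hlm⟩ := List.append_of_mem he
    have hlm' : p.toList = (l ++ [e]) ++ m := by simpa using hlm
    obtain ⟨q, r, h1, h2, h3, -⟩ := path_split p _ _ hlm'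
    refine ⟨q, r, h1, h2, ?_⟩
    obtain ⟨q1, q2, h4, h5, -, h6⟩ := path_split q _ _ h3
    rw [h5, comp_src h4, toList_singleton h6]
    rfl

theorem not_cyc_of_prefix {g : S.G} {μ δ : Path S} (hg : S.gr g = μ.src) (hg' : S.gs g = δ.rng)
    (hμ : 1 ≤ μ.length)
    (H : ∀ ε : Path S, δ.src = ε.rng → IsPrefix S (δ.comp ε) (μ.comp (pact S g (δ.comp ε)))) :
    ¬ CondCyc S := by
  intro hcyc
  have tk : ∀ k : ℕ, ∀ ε ε' : Path S, δ.src = ε.rng → δ.src = ε'.rng →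
      k ≤ (δ.comp ε).toList.length → k ≤ (δ.comp ε').toList.length →
      (δ.comp ε).toList.take k = (δ.comp ε').toList.take k := by
    intro k
    induction k with
    | zero => intros; simp
    | succ k ih =>
      intro ε ε' h h' hk hk'
      have hgd : S.gs g = (δ.comp ε).rng := by simpa using hg'
      have hgd' : S.gs g = (δ.comp ε').rng := by simpa using hg'
      have p1 := ((isPrefix_iff _ _).1 (H ε h)).2
      have p2 := ((isPrefix_iff _ _).1 (H ε' h')).2
      rw [comp_toList (p := μ) (by rw [pact_rng hgd, hg])] at p1
      rw [comp_toList (p := μ) (by rw [pact_rng hgd', hg])] at p2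
      have aux : ∀ {l m : List S.E}, l <+: m → k + 1 ≤ l.length →
          l.take (k + 1) = m.take (k + 1) := by
        rintro l m ⟨t, rfl⟩ hl
        rw [List.take_append_of_le_length hl]
      rw [aux p1 hk, aux p2 hk', List.take_append, List.take_append]
      have hμ' : 1 ≤ μ.toList.length := by rwa [← length_eq]
      congr 1
      refine take_pact hgd (by simp) (by omega) ?_
      have e3 := ih ε ε' h h' (by omega) (by omega)
      have e4 := congrArg (List.take (k + 1 - μ.toList.length)) e3
      rwa [List.take_take, List.take_take, min_eq_left (by omega)] at e4
  have hv : δ.src = (Path.vert S δ.src).rng := rfl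
  have H0 := H (Path.vert S δ.src) rfl
  rw [comp_vert rfl] at H0
  obtain ⟨ν, hν, e1⟩ := H0
  have hr2 : μ.src = (pact S g δ).rng := by rw [pact_rng hg', hg]
  have hlen : ν.length = μ.length := by
    have := congrArg Path.length e1
    rw [length_comp hr2, length_comp hν, pact_length hg'] at this
    omega
  have hsrc : ν.src = S.gr (pres S g δ) := by
    have := congrArg Path.src e1
    rw [comp_src hr2, comp_src hν, pact_src hg'] at this
    exact this.symm
  have hc : GCycle S (S.inv (pres S g δ)) ν :=
    ⟨by omega, by rw [S.gs_inv, hsrc], by rw [S.gr_inv, gs_pres hg', hν]⟩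
  obtain ⟨v, hv, e, f, hef, he, hf⟩ := hcyc _ _ hc
  obtain ⟨q, r, h1, h2, h3⟩ := baseVerts_split hv
  have hq : δ.src = q.rng := by rw [hν, h2, comp_rng]
  have hqe : q.src = (Path.ofEdge S e).rng := by rw [h3, ← he]; rfl
  have hqf : q.src = (Path.ofEdge S f).rng := by rw [h3, ← hf]; rfl
  have hde : δ.src = (q.comp (Path.ofEdge S e)).rng := by simpa using hq
  have hdf : δ.src = (q.comp (Path.ofEdge S f)).rng := by simpa using hq
  have l1 : (δ.comp (q.comp (Path.ofEdge S e))).toList = δ.toList ++ (q.toList ++ [e]) := by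
    rw [comp_toList hde, comp_toList hqe]; rfl
  have l2 : (δ.comp (q.comp (Path.ofEdge S f))).toList = δ.toList ++ (q.toList ++ [f]) := by
    rw [comp_toList hdf, comp_toList hqf]; rfl
  have := tk (δ.toList ++ (q.toList ++ [e])).length _ _ hde hdf (by rw [l1]) (by rw [l2]; simp)
  rw [l1, l2, List.take_length, List.take_of_length_le (by simp)] at this
  simp at this
  exact hef this

theorem core {α β γ : Path S} {g : S.G} (hcyc : CondCyc S)
    (hg : S.gr g = α.src) (hg' : S.gs g = β.src)
    (hfix : (sgeSem S).FixedBy (fIdem S γ) (some (α, g, β))) :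
    α = β ∧ ∃ δ : Path S, β.src = δ.rng ∧ pact S g δ = δ ∧ FixesAll S (pres S g δ) ∧
      IsPrefix S γ (β.comp δ) ∧
      ∀ ζ : Path S, IsPrefix S γ ζ → Comparable S (β.comp δ) ζ := by
  rw [fixedBy_iff hg hg'] at hfix
  obtain ⟨δ, hδ, hγ, hζ⟩ : ∃ δ : Path S, β.src = δ.rng ∧ IsPrefix S γ (β.comp δ) ∧
      ∀ ζ : Path S, IsPrefix S γ ζ → Comparable S (β.comp δ) ζ := by
    rcases (hfix γ (isPrefix_refl γ)).1 with ⟨δ, hδ, rfl⟩ | h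
    · exact ⟨δ, hδ, isPrefix_refl _, fun ζ h => Or.inl h⟩
    · refine ⟨Path.vert S β.src, rfl, ?_, ?_⟩
      · rwa [comp_vert rfl]
      · intro ζ hζ
        rw [comp_vert rfl]
        exact (hfix ζ hζ).1
  have hgδ : S.gs g = δ.rng := hg'.trans hδ
  have hcomp : ∀ ε : Path S, δ.src = ε.rng →
      Comparable S (α.comp (pact S g (δ.comp ε))) (β.comp (δ.comp ε)) := by
    intro ε hε
    refine (hfix (β.comp (δ.comp ε)) ?_).2.1 _ (by simpa using hδ) rfl
    rw [← comp_assoc hδ hε]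
    exact isPrefix_trans hγ (isPrefix_comp (by rwa [comp_src hδ]))
  have hαr : ∀ ε : Path S, α.src = (pact S g (δ.comp ε)).rng := by
    intro ε; rw [pact_rng (by simpa using hgδ), hg]
  have hβr : ∀ ε : Path S, β.src = (δ.comp ε).rng := by
    intro ε; simpa using hδ
  have hgr : ∀ ε : Path S, S.gs g = (δ.comp ε).rng := by
    intro ε; simpa using hgδ
  have hαβ : Comparable S α β := by
    have a1 := isPrefix_comp (hαr (Path.vert S δ.src))
    have a2 := isPrefix_comp (hβr (Path.vert S δ.src))
    rcases hcomp (Path.vert S δ.src) rfl with h | h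
    · exact comparable_of_prefix (isPrefix_trans a1 h) a2
    · exact comparable_of_prefix a1 (isPrefix_trans a2 h)
  have hlen : α = β := by
    rcases hαβ with ⟨μ, hμ, e⟩ | ⟨μ, hμ, e⟩
    · by_cases h0 : μ.toList = []
      · rw [e, eq_vert_of_toList h0, comp_vert hμ]
      exfalso
      subst e
      rw [comp_src hμ] at hg'
      have hig : S.gs (S.inv g) = μ.rng := by rw [S.gs_inv, hg, hμ]
      have hl : 1 ≤ μ.length := by
        rw [length_eq]; exact List.length_pos_of_ne_nil h0
      have hμδ : μ.src = δ.rng := by rw [← hδ, comp_src hμ]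
      have hg2 : S.gs (pres S (S.inv g) μ) = δ.rng := by rw [gs_pres hig, hμδ]
      refine not_cyc_of_prefix (g := pres S (S.inv g) μ) (μ := pact S (S.inv g) μ) (δ := δ)
        (pact_src hig).symm hg2 (by rw [pact_length hig]; exact hl) ?_ hcyc
      intro ε hε
      have hμε : μ.src = (δ.comp ε).rng := by simpa using hμδ
      have h := hcomp ε hε
      rw [comp_assoc hμ hμε, comparable_comp_left (hαr ε) (by simpa using hμ)] at h
      obtain ⟨r, hr, er⟩ := comparable_prefix h
        (by rw [pact_length (hgr ε), length_comp hμε]; omega)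
      rw [← (pact_comp μ (S.inv g) (δ.comp ε) hig hμε).1, er,
        (pact_comp _ _ _ (by rw [pact_rng (hgr ε), S.gs_inv]) hr).1, pact_inv_pact (hgr ε)]
      refine isPrefix_comp ?_
      have hi2 : S.gs (S.inv g) = (pact S g (δ.comp ε)).rng := by rw [pact_rng (hgr ε), S.gs_inv]
      rw [pact_rng (by rw [gs_pres hi2, hr]), ← pact_src hi2, pact_inv_pact (hgr ε)]
    · by_cases h0 : μ.toList = []
      · rw [e, eq_vert_of_toList h0, comp_vert hμ]
      exfalso
      subst e
      rw [comp_src hμ] at hg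
      have hl : 1 ≤ μ.length := by
        rw [length_eq]; exact List.length_pos_of_ne_nil h0
      refine not_cyc_of_prefix (g := g) (μ := μ) (δ := δ) hg hgδ hl ?_ hcyc
      intro ε hε
      have hm : μ.src = (pact S g (δ.comp ε)).rng := by rw [← hαr ε, comp_src hμ]
      have h := hcomp ε hε
      rw [comp_assoc hμ hm, comparable_comp_left (by simpa using hμ) (hβr ε)] at h
      exact comparable_prefix (comparable_symm h)
        (by rw [length_comp hm, pact_length (hgr ε)]; omega)
  subst hlen
  have hall : ∀ ε : Path S, δ.src = ε.rng → pact S g (δ.comp ε) = δ.comp ε := by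
    intro ε hε
    have h := hcomp ε hε
    rw [comparable_comp_left (hαr ε) (hβr ε)] at h
    exact comparable_eq h (pact_length (hgr ε))
  have hδfix : pact S g δ = δ := by
    have := hall (Path.vert S δ.src) rfl
    rwa [comp_vert rfl] at this
  refine ⟨rfl, δ, hδ, hδfix, ?_, hγ, hζ⟩
  intro p hp
  have hp' : δ.src = p.rng := by rw [hp, gs_pres hgδ]
  have := hall p hp'
  rw [(pact_comp δ g p hgδ hp').1, hδfix] at this
  refine comp_cancel ?_ hp' this
  rw [pact_rng hp.symm, ← pact_src hgδ, hδfix]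

theorem sfix_comp {g : S.G} {δ ε : Path S} (hg : S.gs g = δ.rng) (hδ : pact S g δ = δ)
    (h : SFix S (pres S g δ) ε) : δ.src = ε.rng ∧ SFix S g (δ.comp ε) := by
  obtain ⟨h1, h2, h3⟩ := h
  have hde : δ.src = ε.rng := by rw [← h1, gs_pres hg]
  have := pact_comp δ g ε hg hde
  refine ⟨hde, by simpa using hg, ?_, ?_⟩
  · rw [this.1, hδ, h2]
  · rw [this.2, h3, comp_src hde]

theorem not_fixedBy_none (γ : Path S) : ¬ (sgeSem S).FixedBy (fIdem S γ) none := by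
  intro h
  exact h (fIdem S γ) ((nzIdem_iff _).2 ⟨_, rfl⟩) ((le_ff_iff _ _).2 (isPrefix_refl _)) rfl

theorem trivFix_mem {β δ ε : Path S} {g : S.G} (hg : S.gr g = β.src) (hg' : S.gs g = β.src)
    (hδ : β.src = δ.rng) (hfix : pact S g δ = δ) (h : SFix S (pres S g δ) ε) :
    fIdem S ((β.comp δ).comp ε) ∈ (sgeSem S).TrivFix (some (β, g, β)) := by
  obtain ⟨h1, h2⟩ := sfix_comp (hg'.trans hδ) hfix h
  refine ⟨(nzIdem_iff _).2 ⟨_, rfl⟩, ?_⟩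
  rw [le_t_iff hg hg', comp_assoc hδ h1]
  exact ⟨rfl, _, rfl, h2⟩

theorem topFree_of (hcyc : CondCyc S) (hevr : CondEvr S) : (sgeSem S).TopFree := by
  intro t e ht he hfix
  obtain ⟨γ, rfl⟩ := (nzIdem_iff _).1 he
  rcases t with _ | ⟨α, g, β⟩
  · exact absurd hfix (not_fixedBy_none γ)
  obtain ⟨hg, hg'⟩ := ht
  obtain ⟨rfl, δ, hδ, hd, hall, hγ, -⟩ := core hcyc hg hg' hfix
  obtain ⟨ε, hε⟩ := hevr _ hall
  have h1 := (sfix_comp (hg'.trans hδ) hd hε).1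
  refine ⟨_, trivFix_mem hg hg' hδ hd hε, (mul_ff_ne _ _).2 (Or.inr ?_)⟩
  exact isPrefix_trans hγ (isPrefix_comp (by rwa [comp_src hδ]))

theorem effective_of (hcyc : CondCyc S) (hsla : CondSla S) : (sgeSem S).Effective := by
  intro t e ht he hfix
  obtain ⟨γ, rfl⟩ := (nzIdem_iff _).1 he
  rcases t with _ | ⟨α, g, β⟩
  · exact absurd hfix (not_fixedBy_none γ)
  obtain ⟨hg, hg'⟩ := ht
  obtain ⟨rfl, δ, hδ, hd, hall, hγ, hζ⟩ := core hcyc hg hg' hfix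
  obtain ⟨F, hF, hcov⟩ := hsla _ hall
  have hsrc : ∀ ε ∈ F, (α.comp δ).src = ε.rng := by
    intro ε hε
    rw [comp_src hδ]
    exact (sfix_comp (hg'.trans hδ) hd (hF ε hε)).1
  refine ⟨F.image (fun ε => fIdem S ((α.comp δ).comp ε)), ?_, ?_⟩
  · intro x hx
    simp only [Finset.coe_image, Set.mem_image, Finset.mem_coe] at hx
    obtain ⟨ε, hε, rfl⟩ := hx
    exact trivFix_mem hg hg' hδ hd (hF ε hε)
  · intro z hz hle
    obtain ⟨ζ, rfl⟩ := (nzIdem_iff _).1 hz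
    rw [le_ff_iff] at hle
    suffices h : ∃ ε ∈ F, Comparable S ζ ((α.comp δ).comp ε) by
      obtain ⟨ε, hε, h⟩ := h
      refine ⟨fIdem S ((α.comp δ).comp ε), ?_, (mul_ff_ne _ _).2 h⟩
      simp only [Finset.coe_image, Set.mem_image, Finset.mem_coe]
      exact ⟨ε, hε, rfl⟩
    rcases hζ ζ hle with ⟨q, hq, rfl⟩ | h
    · obtain ⟨ε, hε, h⟩ := hcov q (by rw [gs_pres (hg'.trans hδ), ← hq, comp_src hδ])
      exact ⟨ε, hε, (comparable_comp_left hq (hsrc ε hε)).2 (comparable_symm h)⟩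
    · obtain ⟨ε, hε, -⟩ := hcov (Path.vert S (S.gs (pres S g δ))) rfl
      exact ⟨ε, hε, Or.inl (isPrefix_trans h (isPrefix_comp (hsrc ε hε)))⟩

/-! ### The converse directions -/

theorem topFree_of_effective (h : (sgeSem S).Effective) : (sgeSem S).TopFree := by
  intro t e ht he hfix
  obtain ⟨F, hF, hcov⟩ := h t e ht he hfix
  obtain ⟨γ, rfl⟩ := (nzIdem_iff _).1 he
  obtain ⟨f, hf, hne⟩ := hcov (fIdem S γ) he ((le_ff_iff _ _).2 (isPrefix_refl _))
  refine ⟨f, hF hf, ?_⟩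
  obtain ⟨ε, rfl⟩ := (nzIdem_iff _).1 (hF hf).1
  exact (mul_ff_ne _ _).2 (comparable_symm ((mul_ff_ne _ _).1 hne))

theorem fixesAll_fixedBy {g : S.G} (hall : FixesAll S g) :
    S.gr g = S.gs g ∧ (sgeSem S).FixedBy (fIdem S (Path.vert S (S.gs g)))
      (some (Path.vert S (S.gs g), g, Path.vert S (S.gs g))) := by
  have hgg : S.gr g = S.gs g := by
    simpa using congrArg Path.rng (hall (Path.vert S (S.gs g)) rfl)
  refine ⟨hgg, ?_⟩
  rw [fixedBy_iff hgg rfl]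
  intro γ hγ
  refine ⟨Or.inl hγ, ?_, fun _ => Or.inl hγ⟩
  rintro r hr rfl
  rw [hall r hr.symm]
  exact Or.inl (isPrefix_refl _)

theorem trivFix_vert {g : S.G} (hgg : S.gr g = S.gs g) {γ : Path S}
    (h : fIdem S γ ∈ (sgeSem S).TrivFix
      (some (Path.vert S (S.gs g), g, Path.vert S (S.gs g)))) : SFix S g γ := by
  have h2 := h.2
  rw [le_t_iff hgg rfl] at h2
  obtain ⟨-, r, e, hr⟩ := h2
  rw [vert_comp hr.1] at e
  rwa [e]

theorem evr_of_topFree (h : (sgeSem S).TopFree) : CondEvr S := by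
  intro g hall
  obtain ⟨hgg, hfix⟩ := fixesAll_fixedBy hall
  obtain ⟨f, hf, -⟩ := h (some (Path.vert S (S.gs g), g, Path.vert S (S.gs g))) _ ⟨hgg, rfl⟩
    ((nzIdem_iff _).2 ⟨_, rfl⟩) hfix
  obtain ⟨γ, rfl⟩ := (nzIdem_iff _).1 hf.1
  exact ⟨γ, trivFix_vert hgg hf⟩

theorem sla_of_effective (h : (sgeSem S).Effective) : CondSla S := by
  intro g hall
  obtain ⟨hgg, hfix⟩ := fixesAll_fixedBy hall
  obtain ⟨F, hF, hcov⟩ := h (some (Path.vert S (S.gs g), g, Path.vert S (S.gs g))) _ ⟨hgg, rfl⟩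
    ((nzIdem_iff _).2 ⟨_, rfl⟩) hfix
  have hfin : {p : Path S | fIdem S p ∈ F}.Finite :=
    Set.Finite.preimage (f := fIdem S) (fun _ _ _ _ h => fIdem_inj h) F.finite_toSet
  refine ⟨hfin.toFinset, ?_, ?_⟩
  · intro p hp
    rw [Set.Finite.mem_toFinset] at hp
    exact trivFix_vert hgg (hF hp)
  · intro q hq
    obtain ⟨f, hf, hne⟩ := hcov (fIdem S q) ((nzIdem_iff _).2 ⟨_, rfl⟩)
      ((le_ff_iff _ _).2 ⟨q, hq.symm, (vert_comp hq.symm).symm⟩)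
    obtain ⟨p, rfl⟩ := (nzIdem_iff _).1 (hF hf).1
    exact ⟨p, by rw [Set.Finite.mem_toFinset]; exact hf,
      comparable_symm ((mul_ff_ne _ _).1 hne)⟩

theorem es_mem (p : Path S) : ∀ e ∈ p.toList, S.es e = p.src ∨ ∃ e' ∈ p.toList, S.er e' = S.es e := by
  induction p using path_ind with
  | h0 v => intro e he; simp at he
  | h1 f p hf ih =>
    have hf' : (Path.ofEdge S f).src = p.rng := by simpa using hf
    intro e he
    rw [comp_toList hf', comp_src hf']
    rw [comp_toList hf'] at he
    simp only [ofEdge_toList, List.cons_append, List.nil_append, List.mem_cons] at he ⊢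
    rcases he with rfl | he
    · clear ih
      induction p using path_ind with
      | h0 v => left; exact hf
      | h1 k p hk _ =>
        right
        refine ⟨k, Or.inr ?_, ?_⟩
        · rw [comp_toList (by simpa using hk)]; simp
        · simpa using hf.symm
    · rcases ih e he with h | ⟨e', h1, h2⟩
      · exact Or.inl h
      · exact Or.inr ⟨e', Or.inr h1, h2⟩

theorem er_mem (p : Path S) : ∀ e ∈ p.toList, S.er e ∈ p.baseVerts := by
  induction p using path_ind with
  | h0 v => intro e he; simp at he
  | h1 f p hf ih =>
    have hf' : (Path.ofEdge S f).src = p.rng := by simpa using hf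
    intro e he
    rw [comp_toList hf'] at he
    simp only [ofEdge_toList, List.cons_append, List.nil_append, List.mem_cons] at he
    rcases he with rfl | he
    · left; simp
    · right
      rw [comp_toList hf']
      rcases ih e he with h | ⟨e', h1, h2⟩
      · exact ⟨f, by simp, hf.trans h.symm⟩
      · exact ⟨e', by simp [h1], h2⟩

theorem rng_mem {p : Path S} (h : 1 ≤ p.length) : ∃ e ∈ p.toList, S.er e = p.rng := by
  induction p using path_ind with
  | h0 v => simp [length_eq] at h
  | h1 f p hf _ => exact ⟨f, by rw [comp_toList (by simpa using hf)]; simp, by simp⟩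

theorem comparable_of_W (W : S.V → Prop) (h1 : ∀ e, W (S.er e) → W (S.es e))
    (h2 : ∀ e f, W (S.er e) → S.er e = S.er f → e = f) :
    ∀ p q : Path S, W p.rng → p.rng = q.rng → Comparable S p q := by
  intro p
  induction p using path_ind with
  | h0 v =>
    intro q _ h
    exact Or.inl ⟨q, h, (vert_comp h).symm⟩
  | h1 e p he ih =>
    have he' : (Path.ofEdge S e).src = p.rng := by simpa using he
    intro q hW hq
    induction q using path_ind with
    | h0 v => exact Or.inr ⟨_, hq.symm, (vert_comp hq.symm).symm⟩
    | h1 f q hf _ =>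
      have hf' : (Path.ofEdge S f).src = q.rng := by simpa using hf
      simp only [comp_rng, ofEdge_rng] at hW hq
      have := h2 e f hW hq
      subst this
      rw [comparable_comp_left he' hf']
      exact ih q (by rw [← he]; exact h1 e hW) (he.symm.trans hf)

theorem cyc_of_topFree (h : (sgeSem S).TopFree) : CondCyc S := by
  intro g μ hc
  obtain ⟨hl, hs, hr⟩ := hc
  by_contra hno
  have huniq : ∀ e ∈ μ.toList, ∀ f f', S.er f = S.er e → S.er f' = S.er e → f = f' := by
    intro e he f f' h1 h2
    by_contra hne
    exact hno ⟨S.er e, er_mem μ e he, f, f', hne, h1, h2⟩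
  let W : S.V → Prop := fun v => ∃ k : S.G, ∃ e ∈ μ.toList, S.gs k = S.er e ∧ S.gr k = v
  have hstep : ∀ k : S.G, ∀ e ∈ μ.toList, S.gs k = S.er e → ∀ f, S.gr k = S.er f →
      S.act k e = f := by
    intro k e he hk f hf
    have hif : S.gs (S.inv k) = S.er f := by rw [S.gs_inv, hf]
    have e1 : S.act (S.inv k) f = e :=
      huniq e he _ _ (by rw [S.er_act _ _ hif, S.gr_inv, hk]) rfl
    rw [← e1, ← S.act_mul _ _ _ (S.gr_inv k).symm hif, S.mul_inv', hf, S.act_one]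
  have W1 : ∀ e, W (S.er e) → W (S.es e) := by
    rintro f ⟨k, e, he, hk, hf⟩
    have e1 := hstep k e he hk f hf
    have hgs := S.gs_res k e hk
    have hgr := S.gr_res k e hk
    rw [e1] at hgr
    rcases es_mem μ e he with h1 | ⟨e', he', h1⟩
    · obtain ⟨e', he', h2⟩ := rng_mem hl
      have hc : S.gs (S.res k e) = S.gr (S.inv g) := by rw [hgs, h1, S.gr_inv, hs]
      refine ⟨S.mul (S.res k e) (S.inv g), e', he', ?_, ?_⟩
      · rw [S.gs_mul _ _ hc, S.gs_inv, hr, h2]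
      · rw [S.gr_mul _ _ hc, hgr]
    · exact ⟨S.res k e, e', he', by rw [hgs, h1], hgr⟩
  have W2 : ∀ e f, W (S.er e) → S.er e = S.er f → e = f := by
    rintro f f' ⟨k, e, he, hk, hf⟩ hff
    rw [← hstep k e he hk f hf, ← hstep k e he hk f' (hf.trans hff)]
  have hW : W μ.rng := by
    obtain ⟨e', he', h2⟩ := rng_mem hl
    exact ⟨S.one (S.er e'), e', he', S.gs_one _, (S.gr_one _).trans h2⟩
  have hcomp := comparable_of_W W W1 W2
  have hg : S.gr (S.inv g) = μ.src := by rw [S.gr_inv, hs]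
  have hg' : S.gs (S.inv g) = (Path.vert S μ.rng).src := by rw [S.gs_inv, hr]; rfl
  have hfix : (sgeSem S).FixedBy (fIdem S (Path.vert S μ.rng))
      (some (μ, S.inv g, Path.vert S μ.rng)) := by
    rw [fixedBy_iff hg hg']
    intro γ hγ
    have hrng : μ.rng = γ.rng := ((isPrefix_iff _ _).1 hγ).1
    refine ⟨Or.inl hγ, ?_, fun _ => hcomp _ _ hW hrng⟩
    intro r _ _
    exact hcomp _ _ (by simpa using hW) (by simpa using hrng)
  obtain ⟨f, hf, -⟩ := h (some (μ, S.inv g, Path.vert S μ.rng)) _ ⟨hg, hg'⟩ ((nzIdem_iff _).2 ⟨_, rfl⟩) hfix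
  obtain ⟨γ, rfl⟩ := (nzIdem_iff _).1 hf.1
  have e := ((le_t_iff hg hg').1 hf.2).1
  rw [e] at hl
  exact absurd hl (by simp [length_eq])

end SSA

/-- `S(G,E)` is topologically free iff (Cyc) and (Evr) hold, and
`S(G,E)` is effective iff (Cyc) and (Sla) hold. -/
theorem statement6 (S : SSA) :
    ((SSA.sgeSem S).TopFree ↔ SSA.CondCyc S ∧ SSA.CondEvr S) ∧
    ((SSA.sgeSem S).Effective ↔ SSA.CondCyc S ∧ SSA.CondSla S) := by
  exact ⟨⟨fun h => ⟨SSA.cyc_of_topFree h, SSA.evr_of_topFree h⟩, fun h => SSA.topFree_of h.1 h.2⟩,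
    ⟨fun h => ⟨SSA.cyc_of_topFree (SSA.topFree_of_effective h), SSA.sla_of_effective h⟩,
      fun h => SSA.effective_of h.1 h.2⟩⟩

end
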